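/- Let Ω ⊂ ℝⁿ be bounded open satisfying the capacity density condition with Γ = ∂Ω, 1 < p ≤ n, q ∈ (n/p, ∞], and ν a nonnegative measure in the floated Morrey class M^{q,+}_{∂Ω}(Ω). Let u be the weak solution of −Δ_p u = ν in Ω with u = 0 on ∂Ω produced by the existence theorem, satisfying 0 ≤ u(x) ≤ C diam(Ω)^{β−β₀} ‖ν‖^{1/(p−1)} δ(x)^{β₀}. Then for every nonnegative φ ∈ C_c^∞(Ω): ∫_Ω φ^p dν ≤ C^{p−1} diam(Ω)^{(p−1)(β−β₀) + β₀(p−1)} ‖ν‖_{M^q_{∂Ω}(Ω)} ∫_Ω |∇φ|^p dx, i.e. ‖φ‖_{L^p(ν)} ≤ C' diam(Ω)^{1 − n/(pq)} ‖ν‖^{1/p} ‖∇φ‖_{L^p}. -/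

import Mathlib

open MeasureTheory Metric Set
open scoped ENNReal NNReal RealInnerProductSpace

/-- `ℝⁿ` as a Euclidean space. -/
abbrev Euc (n : ℕ) := EuclideanSpace ℝ (Fin n)

/-- The variational `p`-capacity of a pair `K ⊆ U`. -/
noncomputable def pCap (n : ℕ) (p : ℝ) (K U : Set (Euc n)) : ℝ≥0∞ :=
  ⨅ (u : Euc n → ℝ) (_ : ContDiff ℝ (⊤ : ℕ∞) u) (_ : HasCompactSupport u)
    (_ : tsupport u ⊆ U) (_ : ∀ x ∈ K, 1 ≤ u x),
    ∫⁻ x, (‖gradient u x‖₊ : ℝ≥0∞) ^ p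

section Embedding

open Filter Topology Convolution ContinuousLinearMap

theorem Real.mul_rpow_sub_one_mul_le {p a s : ℝ} (hp : 1 < p) (ha : 0 ≤ a) (hs : 0 ≤ s) :
    p * (a ^ (p - 1) * s) ≤ s ^ p + (p - 1) * a ^ p := by
  have h := Real.young_inequality_of_nonneg hs (Real.rpow_nonneg ha (p - 1))
    (Real.HolderConjugate.conjExponent hp)
  have hq : (a ^ (p - 1)) ^ (Real.conjExponent p) = a ^ p := by
    rw [← Real.rpow_mul ha, Real.conjExponent, mul_div_cancel₀ _ (by linarith)]
  rw [hq, Real.conjExponent] at h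
  have hp0 : p ≠ 0 := by positivity
  have hp1 : p - 1 ≠ 0 := by linarith
  calc p * (a ^ (p - 1) * s) = p * (s * a ^ (p - 1)) := by ring
    _ ≤ p * (s ^ p / p + a ^ p / (p / (p - 1))) := by gcongr
    _ = s ^ p + (p - 1) * a ^ p := by field_simp

theorem Real.rpow_sub_one_mul_le_add {p a s : ℝ} (hp : 1 < p) (ha : 0 ≤ a) (hs : 0 ≤ s) :
    a ^ (p - 1) * s ≤ a ^ p + s ^ p := by
  have h : ∀ t : ℝ, 0 ≤ t → t ^ p = t ^ (p - 1) * t := fun t ht => by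
    rw [← Real.rpow_add_one' ht (by linarith)]; ring_nf
  rcases le_total a s with has | has
  · have := Real.rpow_le_rpow ha has (by linarith : 0 ≤ p - 1)
    have := mul_le_mul_of_nonneg_right this hs
    have := Real.rpow_nonneg ha p
    rw [← h s hs] at *; linarith
  · have := mul_le_mul_of_nonneg_left has (Real.rpow_nonneg ha (p - 1))
    have := Real.rpow_nonneg hs p
    rw [← h a ha] at *; linarith

/-- Fatou's lemma for Bochner integrals. -/
theorem MeasureTheory.integrable_and_integral_le_of_tendsto_ae {α : Type*} [MeasurableSpace α]
    {μ : Measure α} {H : ℕ → α → ℝ} {h : α → ℝ} {B : ℝ} (hH : ∀ᶠ k in atTop, Integrable (H k) μ)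
    (hH0 : ∀ᶠ k in atTop, 0 ≤ᵐ[μ] H k) (hB : ∀ᶠ k in atTop, ∫ x, H k x ∂μ ≤ B)
    (hlim : ∀ᵐ x ∂μ, Tendsto (fun k => H k x) atTop (𝓝 (h x))) :
    Integrable h μ ∧ ∫ x, h x ∂μ ≤ B := by
  obtain ⟨N, hN⟩ := eventually_atTop.1 (hH.and (hH0.and hB))
  have hlim' : ∀ᵐ x ∂μ, Tendsto (fun k => H (k + N) x) atTop (𝓝 (h x)) := by
    filter_upwards [hlim] with x hx using (tendsto_add_atTop_iff_nat N).2 hx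
  have hInt : ∀ k, Integrable (H (k + N)) μ := fun k => (hN _ (by omega)).1
  have hnn : ∀ k, 0 ≤ᵐ[μ] H (k + N) := fun k => (hN _ (by omega)).2.1
  have hle : ∀ k, ∫ x, H (k + N) x ∂μ ≤ B := fun k => (hN _ (by omega)).2.2
  have hm : AEStronglyMeasurable h μ :=
    aestronglyMeasurable_of_tendsto_ae atTop (fun k => (hInt k).aestronglyMeasurable) hlim'
  have h0 : 0 ≤ᵐ[μ] h := by
    filter_upwards [hlim', ae_all_iff.2 hnn] with x hx hx0 using ge_of_tendsto' hx hx0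
  have hB0 : 0 ≤ B := (integral_nonneg_of_ae (hnn 0)).trans (hle 0)
  have key : ∫⁻ x, ENNReal.ofReal (h x) ∂μ ≤ ENNReal.ofReal B := by
    calc ∫⁻ x, ENNReal.ofReal (h x) ∂μ
        = ∫⁻ x, liminf (fun k => ENNReal.ofReal (H (k + N) x)) atTop ∂μ := by
          refine lintegral_congr_ae ?_
          filter_upwards [hlim'] with x hx
          exact ((ENNReal.continuous_ofReal.tendsto _).comp hx).liminf_eq.symm
      _ ≤ liminf (fun k => ∫⁻ x, ENNReal.ofReal (H (k + N) x) ∂μ) atTop :=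
          lintegral_liminf_le' fun k => (hInt k).aestronglyMeasurable.aemeasurable.ennreal_ofReal
      _ ≤ ENNReal.ofReal B := by
          refine liminf_le_of_frequently_le' (Eventually.of_forall fun k => ?_).frequently
          rw [← ofReal_integral_eq_lintegral_ofReal (hInt k) (hnn k)]
          exact ENNReal.ofReal_le_ofReal (hle k)
  refine ⟨⟨hm, ?_⟩, ?_⟩
  · rw [hasFiniteIntegral_iff_ofReal h0]
    exact key.trans_lt ENNReal.ofReal_lt_top
  · rw [integral_eq_lintegral_of_nonneg_ae h0 hm]
    exact ENNReal.toReal_le_of_le_ofReal hB0 key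

theorem inner_gradient_mul_rpow {n : ℕ} {f v : Euc n → ℝ} {x : Euc n} (s : ℝ) (F : Euc n)
    (hf : DifferentiableAt ℝ f x) (hv : DifferentiableAt ℝ v x) (hv0 : 0 < v x) :
    ⟪F, gradient (fun y => f y * v y ^ s) x⟫
      = v x ^ s * ⟪F, gradient f x⟫ + s * f x * v x ^ (s - 1) * ⟪F, gradient v x⟫ := by
  have h := hf.hasFDerivAt.mul (hv.hasFDerivAt.rpow_const (p := s) (Or.inl hv0.ne'))
  simp only [inner_gradient_right, RCLike.conj_to_real]
  rw [show (fun y => f y * v y ^ s) = f * fun y => v y ^ s from rfl, h.fderiv]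
  simp
  ring

/-- The gradient of a mollification is the mollification of the weak gradient. -/
theorem gradient_normed_convolution_indicator {n : ℕ} {Ω K : Set (Euc n)} {u : Euc n → ℝ}
    {du : Euc n → Euc n} (hΩ : MeasurableSet Ω) (hK : MeasurableSet K) (hKΩ : K ⊆ Ω)
    (hu : IntegrableOn u K) (hdu : IntegrableOn du K)
    (hweak : ∀ ψ : Euc n → ℝ, ContDiff ℝ (⊤ : ℕ∞) ψ → HasCompactSupport ψ → tsupport ψ ⊆ Ω →
      ∀ i : Fin n, ∫ x in Ω, u x * fderiv ℝ ψ x (EuclideanSpace.single i 1)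
        = - ∫ x in Ω, du x i * ψ x)
    (η : ContDiffBump (0 : Euc n)) {x : Euc n} (hx : closedBall x η.rOut ⊆ K) :
    gradient (η.normed volume ⋆[lsmul ℝ ℝ, volume] K.indicator u) x
      = (η.normed volume ⋆[lsmul ℝ ℝ, volume] K.indicator du) x := by
  have hU : Integrable (K.indicator u) := (integrable_indicator_iff hK).2 hu
  have hD : Integrable (K.indicator du) := (integrable_indicator_iff hK).2 hdu
  have hη := η.hasCompactSupport_normed (μ := (volume : Measure (Euc n)))
  have hηs : ContDiff ℝ (⊤ : ℕ∞) (η.normed (volume : Measure (Euc n))) := η.contDiff_normed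
  have hfd := hη.hasFDerivAt_convolution_left (lsmul ℝ ℝ) (hηs.of_le (by simp))
    hU.locallyIntegrable x
  set ψ : Euc n → ℝ := fun y => η.normed volume (x - y) with hψdef
  have hψ0 : ∀ y, y ∉ K → ψ y = 0 := by
    intro y hy
    by_contra h
    have : x - y ∈ Function.support (η.normed (volume : Measure (Euc n))) := h
    rw [η.support_normed_eq, mem_ball_zero_iff, ← dist_eq_norm, dist_comm] at this
    exact hy (hx this.le)
  have hψt : tsupport ψ ⊆ closedBall x η.rOut := by
    refine closure_minimal (fun y hy => ?_) isClosed_closedBall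
    have : x - y ∈ Function.support (η.normed (volume : Measure (Euc n))) := hy
    rw [η.support_normed_eq, mem_ball_zero_iff, ← dist_eq_norm, dist_comm] at this
    exact this.le
  have hψs : ContDiff ℝ (⊤ : ℕ∞) ψ := hηs.comp (contDiff_const.sub contDiff_id)
  have hψc : HasCompactSupport ψ :=
    HasCompactSupport.of_support_subset_isCompact (isCompact_closedBall x η.rOut)
      (subset_closure.trans hψt)
  have hfψ : ∀ y, fderiv ℝ ψ y = - fderiv ℝ (η.normed volume) (x - y) := by
    intro y
    have h1 : HasFDerivAt (η.normed (volume : Measure (Euc n)))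
        (fderiv ℝ (η.normed volume) (x - y)) (x - y) :=
      ((hηs.differentiable (by simp)) _).hasFDerivAt
    have h2 : HasFDerivAt (fun y : Euc n => x - y) (-ContinuousLinearMap.id ℝ (Euc n)) y := by
      simpa using (hasFDerivAt_id y).const_sub x
    have := h1.comp y h2
    rw [show ψ = (η.normed volume) ∘ fun y => x - y from rfl, this.fderiv]
    ext; simp
  have hf0 : ∀ y, y ∉ K → fderiv ℝ ψ y = 0 := fun y hy => by
    refine image_eq_zero_of_notMem_tsupport fun h => hy (hx (hψt ?_))
    exact tsupport_fderiv_subset ℝ h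
  ext i
  have e1 : gradient (η.normed volume ⋆[lsmul ℝ ℝ, volume] K.indicator u) x i
      = ∫ y, fderiv ℝ (η.normed volume) (x - y) (EuclideanSpace.single i 1)
          * K.indicator u y := by
    have : gradient (η.normed volume ⋆[lsmul ℝ ℝ, volume] K.indicator u) x i
      = fderiv ℝ (η.normed volume ⋆[lsmul ℝ ℝ, volume] K.indicator u) x
        (EuclideanSpace.single i 1) := by
      rw [← inner_gradient_left, real_inner_comm, EuclideanSpace.inner_single_left]; simp
    rw [this, hfd.fderiv, convolution_eq_swap, ContinuousLinearMap.integral_apply]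
    · simp [precompL]
    · have := (hη.fderiv ℝ).convolutionExists_left ((lsmul ℝ ℝ : ℝ →L[ℝ] ℝ →L[ℝ] ℝ).precompL (Euc n))
        (hηs.continuous_fderiv (by simp)) hU.locallyIntegrable x
      exact this.integrable_swap
  have e2 : (η.normed volume ⋆[lsmul ℝ ℝ, volume] K.indicator du) x i
      = ∫ y, ψ y * K.indicator (fun y => du y i) y := by
    rw [convolution_eq_swap]
    have hi := (hη.convolutionExists_left (lsmul ℝ ℝ : ℝ →L[ℝ] Euc n →L[ℝ] Euc n) hηs.continuous
      hD.locallyIntegrable x).integrable_swap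
    have := (EuclideanSpace.proj i : Euc n →L[ℝ] ℝ).integral_comp_comm hi
    refine this.symm.trans (integral_congr_ae (Eventually.of_forall fun y => ?_))
    by_cases hy : y ∈ K <;> simp [hy, ψ]
  have e3 := hweak ψ hψs hψc (hψt.trans (hx.trans hKΩ)) i
  rw [e1, e2]
  have e4 : ∫ y in Ω, u y * fderiv ℝ ψ y (EuclideanSpace.single i 1)
      = - ∫ y, fderiv ℝ (η.normed volume) (x - y) (EuclideanSpace.single i 1)
          * K.indicator u y := by
    rw [← integral_indicator hΩ, ← integral_neg]
    refine integral_congr_ae (Eventually.of_forall fun y => ?_)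
    by_cases hy : y ∈ K
    · simp [hy, hKΩ hy, hfψ, mul_comm]
    · by_cases hy' : y ∈ Ω <;> simp [hy, hy', hf0 y hy]
  have e5 : ∫ y in Ω, du y i * ψ y = ∫ y, ψ y * K.indicator (fun y => du y i) y := by
    rw [← integral_indicator hΩ]
    refine integral_congr_ae (Eventually.of_forall fun y => ?_)
    by_cases hy : y ∈ K
    · simp [hy, hKΩ hy, mul_comm]
    · by_cases hy' : y ∈ Ω <;> simp [hy, hy', hψ0 y hy]
  linarith

theorem norm_rpow_sub_one_mul_norm_convolution_le {n : ℕ} {p : ℝ} (hp : 1 < p) {D : Euc n → Euc n}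
    (hD : Integrable D) (hDp : Integrable fun x => ‖D x‖ ^ p) (η : ContDiffBump (0 : Euc n))
    (x : Euc n) :
    ‖D x‖ ^ (p - 1) * ‖(η.normed volume ⋆[lsmul ℝ ℝ, volume] D) x‖
      ≤ ‖D x‖ ^ p + (η.normed volume ⋆[lsmul ℝ ℝ, volume] fun y => ‖D y‖ ^ p) x := by
  have hη := η.hasCompactSupport_normed (μ := (volume : Measure (Euc n)))
  have hηc := η.continuous_normed (μ := (volume : Measure (Euc n)))
  have h0 : ∀ y, 0 ≤ η.normed (volume : Measure (Euc n)) y := η.nonneg_normed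
  have i1 : Integrable fun y => η.normed volume (x - y) * ‖D y‖ :=
    (hη.convolutionExists_left (lsmul ℝ ℝ : ℝ →L[ℝ] ℝ →L[ℝ] ℝ) hηc
      hD.norm.locallyIntegrable x).integrable_swap
  have i2 : Integrable fun y => η.normed volume (x - y) * ‖D y‖ ^ p :=
    (hη.convolutionExists_left (lsmul ℝ ℝ : ℝ →L[ℝ] ℝ →L[ℝ] ℝ) hηc
      hDp.locallyIntegrable x).integrable_swap
  have i3 : Integrable fun y => η.normed (volume : Measure (Euc n)) (x - y) :=
    (hηc.integrable_of_hasCompactSupport hη).comp_sub_left x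
  have h1 : ∫ y, η.normed (volume : Measure (Euc n)) (x - y) = 1 := by
    rw [integral_sub_left_eq_self (fun y => η.normed (volume : Measure (Euc n)) y) volume x,
      η.integral_normed]
  simp only [convolution_eq_swap, lsmul_apply, smul_eq_mul]
  calc ‖D x‖ ^ (p - 1) * ‖∫ y, η.normed volume (x - y) • D y‖
      ≤ ‖D x‖ ^ (p - 1) * ∫ y, η.normed volume (x - y) * ‖D y‖ := by
        gcongr
        refine (norm_integral_le_integral_norm _).trans_eq (integral_congr_ae (.of_forall fun y => ?_))
        simp [norm_smul, abs_of_nonneg (h0 _)]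
    _ = ∫ y, η.normed volume (x - y) * (‖D x‖ ^ (p - 1) * ‖D y‖) := by
        rw [← integral_const_mul]; congr 1; ext y; ring
    _ ≤ ∫ y, (η.normed volume (x - y) * ‖D x‖ ^ p + η.normed volume (x - y) * ‖D y‖ ^ p) := by
        refine integral_mono ?_ ((i3.mul_const _).add i2) fun y => ?_
        · convert i1.const_mul (‖D x‖ ^ (p - 1)) using 2; ring
        · simp only [← mul_add]
          exact mul_le_mul_of_nonneg_left
            (Real.rpow_sub_one_mul_le_add hp (norm_nonneg _) (norm_nonneg _)) (h0 _)
    _ = ‖D x‖ ^ p + ∫ y, η.normed volume (x - y) * ‖D y‖ ^ p := by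
        rw [integral_add (i3.mul_const _) i2, integral_mul_const, h1, one_mul]

theorem aestronglyMeasurable_of_integrableOn_flux {n : ℕ} {p : ℝ} (hp : 1 < p)
    {Ω K : Set (Euc n)} (hΩ : IsOpen Ω) (hK : IsCompact K) (hKΩ : K ⊆ Ω) {du : Euc n → Euc n}
    (hdu : IntegrableOn (fun x => ‖du x‖ ^ p) K)
    (hflux : ∀ ψ : Euc n → ℝ, ContDiff ℝ (⊤ : ℕ∞) ψ → HasCompactSupport ψ → tsupport ψ ⊆ Ω →
      IntegrableOn (fun x => ‖du x‖ ^ (p - 2) * ⟪du x, gradient ψ x⟫) Ω) :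
    AEStronglyMeasurable du (volume.restrict K) := by
  obtain ⟨L, hL, hKL, hLΩ⟩ := exists_compact_between hK hΩ hKΩ
  obtain ⟨χ, hχ1, hχ0, -⟩ := exists_contMDiffMap_one_nhds_of_subset_interior
    (n := (⊤ : ℕ∞)) (modelWithCornersSelf ℝ (Euc n)) hK.isClosed hKL
  have hχs : ContDiff ℝ (⊤ : ℕ∞) χ := χ.contMDiff.contDiff
  have hnorm : AEMeasurable (fun x => ‖du x‖) (volume.restrict K) := by
    have := hdu.aestronglyMeasurable.aemeasurable.pow_const p⁻¹
    refine this.congr (.of_forall fun x => ?_)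
    exact Real.rpow_rpow_inv (norm_nonneg _) (by linarith)
  have hcoord : ∀ i, AEMeasurable (fun x => ‖du x‖ ^ (p - 2) * du x i) (volume.restrict K) := by
    intro i
    set ψ : Euc n → ℝ := fun x => χ x * x i
    have hψs : ContDiff ℝ (⊤ : ℕ∞) ψ :=
      hχs.mul (EuclideanSpace.proj i : Euc n →L[ℝ] ℝ).contDiff
    have hsupp : tsupport ψ ⊆ L := closure_minimal (fun x hx => by
      by_contra hxL
      exact hx (by simp [ψ, hχ0 x hxL])) hL.isClosed
    have hInt := hflux ψ hψs (hL.of_isClosed_subset (isClosed_tsupport _) hsupp) (hsupp.trans hLΩ)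
    refine (hInt.mono_set hKΩ).aestronglyMeasurable.aemeasurable.congr ?_
    filter_upwards [ae_restrict_mem hK.measurableSet] with x hx
    congr 1
    have hev : ψ =ᶠ[𝓝 x] (EuclideanSpace.proj i : Euc n →L[ℝ] ℝ) := by
      filter_upwards [(hχ1.filter_mono (nhds_le_nhdsSet hx))] with y hy
      simp [ψ, hy]
    rw [inner_gradient_right, hev.fderiv_eq, ContinuousLinearMap.fderiv]
    simp
  have hcoord' : ∀ i, AEMeasurable (fun x => du x i) (volume.restrict K) := by
    intro i
    refine ((hnorm.pow_const (2 - p)).mul (hcoord i)).congr (.of_forall fun x => ?_)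
    simp only [Pi.mul_apply]
    rcases eq_or_ne (du x) 0 with h | h
    · simp [h]
    · rw [← mul_assoc, ← Real.rpow_add (norm_pos_iff.2 h)]
      simp
  have := (WithLp.measurable_toLp 2 (Fin n → ℝ)).comp_aemeasurable
    (aemeasurable_pi_lambda _ hcoord')
  exact AEMeasurable.aestronglyMeasurable this

/-- A weak supersolution may be tested with `Φ / (u + ε) ^ (p - 1)`. -/
theorem integral_mul_le_integral_flux {n : ℕ} {p : ℝ} (hp : 1 < p) {Ω : Set (Euc n)}
    (hΩ : IsOpen Ω) {ν : Measure (Euc n)} [IsFiniteMeasureOnCompacts ν] {u : Euc n → ℝ}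
    {du : Euc n → Euc n} {S : ℝ} (hS : 0 ≤ S) (hu0 : ∀ x ∈ Ω, 0 ≤ u x) (huS : ∀ x ∈ Ω, u x ≤ S)
    (huloc : ∀ K : Set (Euc n), IsCompact K → K ⊆ Ω →
      IntegrableOn u K volume ∧ IntegrableOn (fun x => ‖du x‖ ^ p) K volume)
    (hweak : ∀ ψ : Euc n → ℝ, ContDiff ℝ (⊤ : ℕ∞) ψ → HasCompactSupport ψ → tsupport ψ ⊆ Ω →
      ∀ i : Fin n, ∫ x in Ω, u x * fderiv ℝ ψ x (EuclideanSpace.single i 1)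
        = - ∫ x in Ω, du x i * ψ x)
    (hsol : ∀ ψ : Euc n → ℝ, ContDiff ℝ (⊤ : ℕ∞) ψ → HasCompactSupport ψ → tsupport ψ ⊆ Ω →
      ∫ x in Ω, ‖du x‖ ^ (p - 2) * ⟪du x, gradient ψ x⟫ = ∫ x, ψ x ∂ν)
    (hflux : ∀ ψ : Euc n → ℝ, ContDiff ℝ (⊤ : ℕ∞) ψ → HasCompactSupport ψ → tsupport ψ ⊆ Ω →
      IntegrableOn (fun x => ‖du x‖ ^ (p - 2) * ⟪du x, gradient ψ x⟫) Ω)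
    {Φ : Euc n → ℝ} (hΦ : ContDiff ℝ (⊤ : ℕ∞) Φ) (hΦc : HasCompactSupport Φ)
    (hΦΩ : tsupport Φ ⊆ Ω) (hΦ0 : ∀ x, 0 ≤ Φ x) {ε : ℝ} (hε : 0 < ε) :
    IntegrableOn (fun x => ‖du x‖ ^ (p - 2) * ((u x + ε) ^ (1 - p) * ⟪du x, gradient Φ x⟫
      + (1 - p) * Φ x * (u x + ε) ^ (1 - p - 1) * ⟪du x, du x⟫)) Ω ∧
    (∫ x, Φ x ∂ν) * (S + ε) ^ (1 - p) ≤
      ∫ x in Ω, ‖du x‖ ^ (p - 2) * ((u x + ε) ^ (1 - p) * ⟪du x, gradient Φ x⟫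
        + (1 - p) * Φ x * (u x + ε) ^ (1 - p - 1) * ⟪du x, du x⟫) := by
  set f : Euc n → ℝ := fun x => ‖du x‖ ^ (p - 2) * ((u x + ε) ^ (1 - p) * ⟪du x, gradient Φ x⟫
      + (1 - p) * Φ x * (u x + ε) ^ (1 - p - 1) * ⟪du x, du x⟫) with hf
  set T := tsupport Φ with hT
  have hTc : IsCompact T := hΦc
  obtain ⟨r, hr, hrΩ⟩ := hTc.exists_cthickening_subset_open hΩ hΦΩ
  set K := cthickening r T with hKdef
  have hK : IsCompact K := hTc.cthickening
  have hTK : T ⊆ K := self_subset_cthickening T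
  have hKm : MeasurableSet K := hK.measurableSet
  have hu : IntegrableOn u K := (huloc K hK hrΩ).1
  have hdup : IntegrableOn (fun x => ‖du x‖ ^ p) K := (huloc K hK hrΩ).2
  have hdum := aestronglyMeasurable_of_integrableOn_flux hp hΩ hK hrΩ hdup hflux
  have hle1 : ∀ a : ℝ, 0 ≤ a → a ^ (p - 1) ≤ a ^ p + 1 := fun a ha => by
    simpa using Real.rpow_sub_one_mul_le_add hp ha zero_le_one
  have hKone : IntegrableOn (fun _ : Euc n => (1 : ℝ)) K := integrableOn_const hK.measure_lt_top.ne
  have hdu : IntegrableOn du K := by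
    refine Integrable.mono' (hdup.add hKone) hdum (.of_forall fun x => ?_)
    have := Real.rpow_sub_one_mul_le_add hp zero_le_one (norm_nonneg (du x))
    simp only [Real.one_rpow, one_mul, Pi.add_apply] at *
    linarith
  set U := K.indicator u with hU
  set D := K.indicator du with hD
  set g : Euc n → ℝ := fun x => ‖D x‖ ^ p with hg
  have hUi : Integrable U := (integrable_indicator_iff hKm).2 hu
  have hDi : Integrable D := (integrable_indicator_iff hKm).2 hdu
  have hgK : g = K.indicator fun x => ‖du x‖ ^ p := by
    ext x
    by_cases hx : x ∈ K
    · simp [hg, hD, hx]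
    · simp [hg, hD, hx, Real.zero_rpow (by linarith : p ≠ 0)]
  have hgi : Integrable g := by
    rw [hgK]; exact (integrable_indicator_iff hKm).2 hdup
  have hg0 : ∀ x, 0 ≤ g x := fun x => by positivity
  let η : ℕ → ContDiffBump (0 : Euc n) := fun k =>
    ⟨1 / ((k : ℝ) + 1), 2 / ((k : ℝ) + 1), by positivity, by gcongr; norm_num⟩
  have hηlim : Tendsto (fun k => (η k).rOut) atTop (𝓝 0) := by
    have := (tendsto_one_div_add_atTop_nhds_zero_nat (𝕜 := ℝ)).const_mul 2
    refine (this.congr fun k => ?_).trans (by simp)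
    simp [η, div_eq_mul_inv]
  have hηK : ∀ᶠ k in atTop, (η k).rOut ≤ 2 * (η k).rIn := .of_forall fun k => by
    simp [η, div_eq_mul_inv]
  set Uk : ℕ → Euc n → ℝ := fun k => (η k).normed volume ⋆[lsmul ℝ ℝ, volume] U with hUk
  set Dk : ℕ → Euc n → Euc n := fun k => (η k).normed volume ⋆[lsmul ℝ ℝ, volume] D with hDk
  set gk : ℕ → Euc n → ℝ := fun k => (η k).normed volume ⋆[lsmul ℝ ℝ, volume] g with hgk
  have hUlim := ContDiffBump.ae_convolution_tendsto_right_of_locallyIntegrable (μ := volume) hηlim hηK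
    hUi.locallyIntegrable
  have hDlim := ContDiffBump.ae_convolution_tendsto_right_of_locallyIntegrable (μ := volume) hηlim hηK
    hDi.locallyIntegrable
  have hglim := ContDiffBump.ae_convolution_tendsto_right_of_locallyIntegrable (μ := volume) hηlim hηK
    hgi.locallyIntegrable
  have hηs : ∀ k, ContDiff ℝ (⊤ : ℕ∞) ((η k).normed (volume : Measure (Euc n))) :=
    fun k => (η k).contDiff_normed
  have hηc : ∀ k, HasCompactSupport ((η k).normed (volume : Measure (Euc n))) :=
    fun k => (η k).hasCompactSupport_normed
  have hη0 : ∀ k x, 0 ≤ (η k).normed (volume : Measure (Euc n)) x := fun k => (η k).nonneg_normed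
  have hηi : ∀ k, Integrable ((η k).normed (volume : Measure (Euc n))) := fun k =>
    (hηs k).continuous.integrable_of_hasCompactSupport (hηc k)
  have hUks : ∀ k, ContDiff ℝ (⊤ : ℕ∞) (Uk k) := fun k =>
    (hηc k).contDiff_convolution_left _ (hηs k) hUi.locallyIntegrable
  have hU0 : ∀ x, 0 ≤ U x := fun x => indicator_nonneg (fun y hy => hu0 y (hrΩ hy)) x
  have hUS : ∀ x, U x ≤ S := fun x => indicator_le' (fun y hy => huS y (hrΩ hy)) (fun _ _ => hS) x
  have hUk0 : ∀ k x, 0 ≤ Uk k x := fun k x =>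
    integral_nonneg fun y => mul_nonneg (hη0 k y) (hU0 _)
  have hUkS : ∀ k x, Uk k x ≤ S := fun k x => by
    have h1 := ((hηc k).convolutionExists_left (lsmul ℝ ℝ : ℝ →L[ℝ] ℝ →L[ℝ] ℝ) (hηs k).continuous
      hUi.locallyIntegrable x).integrable
    calc Uk k x ≤ ∫ y, (η k).normed volume y * S :=
          integral_mono h1 ((hηi k).mul_const S)
            fun y => mul_le_mul_of_nonneg_left (hUS _) (hη0 k y)
      _ = S := by rw [integral_mul_const, (η k).integral_normed, one_mul]
  have hgk0 : ∀ k x, 0 ≤ gk k x := fun k x =>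
    integral_nonneg fun y => mul_nonneg (hη0 k y) (hg0 _)
  have hgki : ∀ k, Integrable (gk k) := fun k => (hηi k).integrable_convolution _ hgi
  have hgkint : ∀ k, ∫ x in Ω, gk k x ≤ ∫ x in Ω, g x := fun k => by
    calc ∫ x in Ω, gk k x ≤ ∫ x, gk k x :=
          setIntegral_le_integral (hgki k) (.of_forall (hgk0 k))
      _ = ∫ x, g x := by
          rw [hgk]
          simp only
          rw [integral_convolution _ (hηi k) hgi, (η k).integral_normed]
          simp
      _ = ∫ x in Ω, g x := by
          refine (setIntegral_eq_integral_of_forall_compl_eq_zero fun x hx => ?_).symm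
          rw [hgK]
          exact indicator_of_notMem (fun h => hx (hrΩ h)) _
  set ψ : ℕ → Euc n → ℝ := fun k x => Φ x * (Uk k x + ε) ^ (1 - p) with hψ
  have hpos : ∀ k x, 0 < Uk k x + ε := fun k x => by linarith [hUk0 k x]
  have hψs : ∀ k, ContDiff ℝ (⊤ : ℕ∞) (ψ k) := fun k =>
    hΦ.mul (((hUks k).add contDiff_const).rpow_const_of_ne fun x => (hpos k x).ne')
  have hψT : ∀ k, tsupport (ψ k) ⊆ T := fun k => tsupport_mul_subset_left
  have hψc : ∀ k, HasCompactSupport (ψ k) := fun k => hΦc.mul_right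
  set fk : ℕ → Euc n → ℝ := fun k x => ‖du x‖ ^ (p - 2) * ⟪du x, gradient (ψ k) x⟫ with hfk
  have hfki : ∀ k, IntegrableOn (fk k) Ω := fun k =>
    hflux (ψ k) (hψs k) (hψc k) ((hψT k).trans hΦΩ)
  have hLfk : ∀ k, (∫ x, Φ x ∂ν) * (S + ε) ^ (1 - p) ≤ ∫ x in Ω, fk k x := fun k => by
    rw [hfk]
    simp only
    rw [hsol (ψ k) (hψs k) (hψc k) ((hψT k).trans hΦΩ), ← integral_mul_const]
    refine integral_mono ((hΦ.continuous.integrable_of_hasCompactSupport hΦc).mul_const _)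
      ((hψs k).continuous.integrable_of_hasCompactSupport (hψc k)) fun x => ?_
    refine mul_le_mul_of_nonneg_left ?_ (hΦ0 x)
    exact Real.rpow_le_rpow_of_nonpos (hpos k x) (by linarith [hUkS k x]) (by linarith)
  have hgrad0 : ∀ h : Euc n → ℝ, tsupport h ⊆ T → ∀ x, x ∉ T → gradient h x = 0 := by
    intro h hh x hx
    have : fderiv ℝ h x = 0 := image_eq_zero_of_notMem_tsupport fun h' =>
      hx (hh (tsupport_fderiv_subset ℝ h'))
    rw [gradient, this, map_zero]
  have hfkT : ∀ k x, x ∉ T → fk k x = 0 := fun k x hx => by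
    simp only [hfk, hgrad0 (ψ k) (hψT k) x hx, inner_zero_right, mul_zero]
  have hfT : ∀ x, x ∉ T → f x = 0 := fun x hx => by
    simp only [hf, hgrad0 Φ subset_rfl x hx, image_eq_zero_of_notMem_tsupport hx, inner_zero_right,
      mul_zero, zero_mul, add_zero]
  have hfk_eq : ∀ᶠ k in atTop, ∀ x ∈ T, fk k x = ‖du x‖ ^ (p - 2) *
      ((Uk k x + ε) ^ (1 - p) * ⟪du x, gradient Φ x⟫
        + (1 - p) * Φ x * (Uk k x + ε) ^ (1 - p - 1) * ⟪du x, Dk k x⟫) := by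
    filter_upwards [hηlim.eventually_lt_const hr] with k hk x hx
    have hball : closedBall x (η k).rOut ⊆ K :=
      (closedBall_subset_closedBall hk.le).trans (closedBall_subset_cthickening hx r)
    have hg := gradient_normed_convolution_indicator hΩ.measurableSet hKm hrΩ hu hdu hweak
      (η k) hball
    have hUd : DifferentiableAt ℝ (Uk k) x := (hUks k).differentiable (by simp) x
    have := inner_gradient_mul_rpow (1 - p) (du x) (hΦ.differentiable (by simp) x)
      (hUd.add_const ε) (hpos k x)
    have hadd : gradient (fun y => Uk k y + ε) x = Dk k x := by
      refine Eq.trans ?_ hg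
      rw [gradient, fderiv_add_const]; rfl
    rw [hadd] at this
    simp only [hfk, hψ, this]
  obtain ⟨C₁, hC₁⟩ : ∃ C, ∀ x, ‖gradient Φ x‖ ≤ C := by
    obtain ⟨C, hC⟩ := (hΦ.continuous_fderiv (by simp)).bounded_above_of_compact_support
      (hΦc.fderiv ℝ)
    exact ⟨C, fun x => by simpa [gradient] using hC x⟩
  obtain ⟨C₂, hC₂⟩ := hΦ.continuous.bounded_above_of_compact_support hΦc
  have hC₁0 : 0 ≤ C₁ := (norm_nonneg _).trans (hC₁ 0)
  have hC₂0 : 0 ≤ C₂ := (norm_nonneg _).trans (hC₂ 0)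
  set A : ℝ := ε ^ (1 - p) * C₁ + (p - 1) * C₂ * ε ^ (1 - p - 1) with hA
  have hA1 : 0 ≤ ε ^ (1 - p) * C₁ := by positivity
  have hA2 : 0 ≤ (p - 1) * C₂ * ε ^ (1 - p - 1) :=
    mul_nonneg (mul_nonneg (by linarith) hC₂0) (by positivity)
  set G : Euc n → ℝ := fun x => K.indicator (fun _ => (1 : ℝ)) x + 2 * g x with hG
  have hGi : Integrable G :=
    ((integrable_indicator_iff hKm).2 hKone).add (hgi.const_mul 2)
  have hG0 : ∀ x, 0 ≤ G x := fun x =>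
    add_nonneg (indicator_nonneg (fun _ _ => zero_le_one) x) (mul_nonneg zero_le_two (hg0 x))
  have hdom : ∀ᶠ k in atTop, ∀ x, fk k x ≤ A * (G x + gk k x) := by
    filter_upwards [hfk_eq] with k hk x
    by_cases hx : x ∈ T
    · have hDx : D x = du x := indicator_of_mem (hTK hx) _
      have hGx : G x = 1 + 2 * g x := by simp [hG, hTK hx]
      have hconv := norm_rpow_sub_one_mul_norm_convolution_le hp hDi hgi (η k) x
      have hnorm : ‖du x‖ ^ (p - 2) * ‖du x‖ = ‖du x‖ ^ (p - 1) := by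
        rw [← Real.rpow_add_one' (norm_nonneg _) (by linarith)]; ring_nf
      have hε1 : (Uk k x + ε) ^ (1 - p) ≤ ε ^ (1 - p) :=
        Real.rpow_le_rpow_of_nonpos hε (by linarith [hUk0 k x]) (by linarith)
      have hε2 : (Uk k x + ε) ^ (1 - p - 1) ≤ ε ^ (1 - p - 1) :=
        Real.rpow_le_rpow_of_nonpos hε (by linarith [hUk0 k x]) (by linarith)
      have hv1 : 0 ≤ (Uk k x + ε) ^ (1 - p) := Real.rpow_nonneg (hpos k x).le _
      have hv2 : 0 ≤ (Uk k x + ε) ^ (1 - p - 1) := Real.rpow_nonneg (hpos k x).le _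
      have ht1 : (Uk k x + ε) ^ (1 - p) * ⟪du x, gradient Φ x⟫
          ≤ ‖du x‖ * (ε ^ (1 - p) * C₁) := by
        calc _ ≤ (Uk k x + ε) ^ (1 - p) * (‖du x‖ * ‖gradient Φ x‖) := by
              gcongr; exact real_inner_le_norm _ _
          _ ≤ ε ^ (1 - p) * (‖du x‖ * C₁) := by gcongr; exact hC₁ x
          _ = _ := by ring
      have ht2 : (1 - p) * Φ x * (Uk k x + ε) ^ (1 - p - 1) * ⟪du x, Dk k x⟫
          ≤ ‖du x‖ * ((p - 1) * C₂ * ε ^ (1 - p - 1) * ‖Dk k x‖) := by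
        have hp1 : 0 ≤ p - 1 := by linarith
        have hΦC : Φ x ≤ C₂ := (le_abs_self _).trans (hC₂ x)
        have hΦx := hΦ0 x
        calc _ = (p - 1) * Φ x * (Uk k x + ε) ^ (1 - p - 1) * (- ⟪du x, Dk k x⟫) := by ring
          _ ≤ (p - 1) * Φ x * (Uk k x + ε) ^ (1 - p - 1) * (‖du x‖ * ‖Dk k x‖) := by
              gcongr
              exact (neg_le_abs _).trans (abs_real_inner_le_norm _ _)
          _ ≤ (p - 1) * C₂ * ε ^ (1 - p - 1) * (‖du x‖ * ‖Dk k x‖) := by gcongr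
          _ = _ := by ring
      rw [hDx] at hconv
      have hgx : g x = ‖du x‖ ^ p := by simp only [hg, hDx]
      have h1 := hle1 _ (norm_nonneg (du x))
      have hgk0' := hgk0 k x
      have hg0' := hg0 x
      rw [← hgx] at h1 hconv
      calc fk k x ≤ ‖du x‖ ^ (p - 2) * (‖du x‖ * (ε ^ (1 - p) * C₁)
            + ‖du x‖ * ((p - 1) * C₂ * ε ^ (1 - p - 1) * ‖Dk k x‖)) := by
            rw [hk x hx]; gcongr
        _ = ε ^ (1 - p) * C₁ * ‖du x‖ ^ (p - 1)
            + (p - 1) * C₂ * ε ^ (1 - p - 1) * (‖du x‖ ^ (p - 1) * ‖Dk k x‖) := by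
            rw [← hnorm]; ring
        _ ≤ ε ^ (1 - p) * C₁ * (G x + gk k x)
            + (p - 1) * C₂ * ε ^ (1 - p - 1) * (G x + gk k x) := by
            refine add_le_add (mul_le_mul_of_nonneg_left ?_ hA1) (mul_le_mul_of_nonneg_left ?_ hA2)
            · linarith
            · refine hconv.trans ?_
              change g x + gk k x ≤ _
              linarith
        _ = A * (G x + gk k x) := by ring
    · rw [hfkT k x hx]
      exact mul_nonneg (add_nonneg hA1 hA2) (add_nonneg (hG0 x) (hgk0 k x))
  have hlim : ∀ᵐ x, Tendsto (fun k => fk k x) atTop (𝓝 (f x)) := by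
    filter_upwards [hUlim, hDlim] with x hUx hDx
    by_cases hx : x ∈ T
    · have hDx' : D x = du x := indicator_of_mem (hTK hx) _
      have hUx' : U x = u x := indicator_of_mem (hTK hx) _
      rw [hDx'] at hDx
      rw [hUx'] at hUx
      have hux : 0 < u x + ε := by linarith [hu0 x (hΦΩ hx)]
      have hr : ∀ s : ℝ, Tendsto (fun k => (Uk k x + ε) ^ s) atTop (𝓝 ((u x + ε) ^ s)) :=
        fun s => (hUx.add_const ε).rpow_const (Or.inl hux.ne')
      have hin : Tendsto (fun k => ⟪du x, Dk k x⟫) atTop (𝓝 ⟪du x, du x⟫) :=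
        tendsto_const_nhds.inner hDx
      refine Tendsto.congr' ?_ ((((hr (1 - p)).mul_const ⟪du x, gradient Φ x⟫).add
        (((hr (1 - p - 1)).const_mul ((1 - p) * Φ x)).mul hin)).const_mul (‖du x‖ ^ (p - 2)))
      filter_upwards [hfk_eq] with k hk
      exact (hk x hx).symm
    · simp [hfkT _ x hx, hfT x hx]
  set L := (∫ x, Φ x ∂ν) * (S + ε) ^ (1 - p) with hL
  have hAi : Integrable (fun x => A * (G x + g x)) (volume.restrict Ω) :=
    ((hGi.add hgi).const_mul A).integrableOn
  have hAki : ∀ k, Integrable (fun x => A * (G x + gk k x)) (volume.restrict Ω) := fun k =>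
    ((hGi.add (hgki k)).const_mul A).integrableOn
  obtain ⟨hHi, hHle⟩ := integrable_and_integral_le_of_tendsto_ae (μ := volume.restrict Ω)
    (H := fun k x => A * (G x + gk k x) - fk k x) (h := fun x => A * (G x + g x) - f x)
    (B := (∫ x in Ω, A * (G x + g x)) - L)
    (.of_forall fun k => (hAki k).sub (hfki k))
    (hdom.mono fun k hk => .of_forall fun x => sub_nonneg.2 (hk x))
    (.of_forall fun k => by
      rw [integral_sub (hAki k) (hfki k), integral_const_mul, integral_const_mul,
        integral_add hGi.integrableOn (hgki k).integrableOn,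
        integral_add hGi.integrableOn hgi.integrableOn]
      have := mul_le_mul_of_nonneg_left (hgkint k) (add_nonneg hA1 hA2)
      have := hLfk k
      rw [← hA] at *
      linarith)
    (by
      filter_upwards [ae_restrict_of_ae hlim, ae_restrict_of_ae hglim] with x h1 h2
      exact ((h2.const_add _).const_mul A).sub h1)
  have hfi : IntegrableOn f Ω := by
    refine (hAi.sub hHi).congr (.of_forall fun x => ?_)
    simp
  refine ⟨hfi, ?_⟩
  rw [integral_sub hAi hfi] at hHle
  linarith

/-- Picone's inequality for the regularized power `(a ^ 2 + δ ^ 2) ^ (p / 2) - δ ^ p`. -/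
theorem picone_regularized {n : ℕ} {p : ℝ} (hp : 1 < p) (X Y : Euc n) {a δ ε v : ℝ} (ha : 0 ≤ a)
    (hδ : 0 < δ) (hε : 0 < ε) (hv : ε ≤ v) :
    ‖X‖ ^ (p - 2) * (v ^ (1 - p) * (p * a * (a ^ 2 + δ ^ 2) ^ (p / 2 - 1) * ⟪X, Y⟫)
      + (1 - p) * ((a ^ 2 + δ ^ 2) ^ (p / 2) - (δ ^ 2) ^ (p / 2)) * v ^ (1 - p - 1) * ⟪X, X⟫)
    ≤ ‖Y‖ ^ p + (p - 1) * (δ ^ 2) ^ (p / 2) * ε ^ (-p) * ‖X‖ ^ p := by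
  have hv0 : 0 < v := hε.trans_le hv
  set R := √(a ^ 2 + δ ^ 2) with hR
  have hR0 : 0 < R := Real.sqrt_pos.2 (by positivity)
  have hRs : a ^ 2 + δ ^ 2 = R ^ (2 : ℝ) := by
    rw [Real.rpow_two, hR, Real.sq_sqrt (by positivity)]
  have haR : a ≤ R := Real.le_sqrt_of_sq_le (by linarith [sq_nonneg δ])
  have e1 : (a ^ 2 + δ ^ 2) ^ (p / 2 - 1) = R ^ (p - 2) := by
    rw [hRs, ← Real.rpow_mul hR0.le]; ring_nf
  have e2 : (a ^ 2 + δ ^ 2) ^ (p / 2) = R ^ p := by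
    rw [hRs, ← Real.rpow_mul hR0.le]; ring_nf
  have e3 : R ^ (p - 2) * R = R ^ (p - 1) := by
    rw [← Real.rpow_add_one hR0.ne']; ring_nf
  have e4 : ‖X‖ ^ (p - 2) * ‖X‖ = ‖X‖ ^ (p - 1) := by
    rw [← Real.rpow_add_one' (norm_nonneg _) (by linarith)]; ring_nf
  have e5 : ‖X‖ ^ (p - 2) * ⟪X, X⟫ = ‖X‖ ^ p := by
    rw [real_inner_self_eq_norm_mul_norm, ← mul_assoc, e4,
      ← Real.rpow_add_one' (norm_nonneg _) (by linarith)]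
    ring_nf
  have e6 : (R * ‖X‖ / v) ^ (p - 1) = R ^ (p - 1) * ‖X‖ ^ (p - 1) * v ^ (1 - p) := by
    rw [Real.div_rpow (by positivity) hv0.le, Real.mul_rpow hR0.le (norm_nonneg _), div_eq_mul_inv,
      ← Real.rpow_neg hv0.le]
    ring_nf
  have e7 : (R * ‖X‖ / v) ^ p = R ^ p * ‖X‖ ^ p * v ^ (-p) := by
    rw [Real.div_rpow (by positivity) hv0.le, Real.mul_rpow hR0.le (norm_nonneg _), div_eq_mul_inv,
      ← Real.rpow_neg hv0.le]
  have hyoung := Real.mul_rpow_sub_one_mul_le hp (a := R * ‖X‖ / v) (by positivity) (norm_nonneg Y)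
  rw [e6, e7] at hyoung
  have hfirst : ‖X‖ ^ (p - 2) * (v ^ (1 - p) * (p * a * R ^ (p - 2) * ⟪X, Y⟫))
      ≤ p * (R ^ (p - 1) * ‖X‖ ^ (p - 1) * v ^ (1 - p) * ‖Y‖) := by
    calc _ ≤ ‖X‖ ^ (p - 2) * (v ^ (1 - p) * (p * R * R ^ (p - 2) * (‖X‖ * ‖Y‖))) := by
          refine mul_le_mul_of_nonneg_left (mul_le_mul_of_nonneg_left ?_ (by positivity))
            (by positivity)
          calc p * a * R ^ (p - 2) * ⟪X, Y⟫ ≤ p * a * R ^ (p - 2) * (‖X‖ * ‖Y‖) := by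
                gcongr; exact real_inner_le_norm _ _
            _ ≤ _ := by gcongr
      _ = _ := by rw [← e3, ← e4]; ring
  have hthird : (δ ^ 2) ^ (p / 2) * v ^ (-p) * ‖X‖ ^ p
      ≤ (δ ^ 2) ^ (p / 2) * ε ^ (-p) * ‖X‖ ^ p := by
    have := Real.rpow_le_rpow_of_nonpos hε hv (by linarith : -p ≤ 0)
    gcongr
  have hthird' := mul_le_mul_of_nonneg_left hthird (by linarith : 0 ≤ p - 1)
  rw [e1, e2, show 1 - p - 1 = -p by ring]
  calc _ = ‖X‖ ^ (p - 2) * (v ^ (1 - p) * (p * a * R ^ (p - 2) * ⟪X, Y⟫))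
        + (1 - p) * (R ^ p - (δ ^ 2) ^ (p / 2)) * v ^ (-p) * (‖X‖ ^ (p - 2) * ⟪X, X⟫) := by ring
    _ ≤ _ := by rw [e5]; linarith

/-- Picone's inequality for a bounded weak solution tested with the regularized power of `φ`. -/
theorem integral_regularized_mul_le {n : ℕ} {p : ℝ} (hp : 1 < p) {Ω : Set (Euc n)}
    (hΩ : IsOpen Ω) {ν : Measure (Euc n)} [IsFiniteMeasureOnCompacts ν] {u : Euc n → ℝ}
    {du : Euc n → Euc n} {S : ℝ} (hS : 0 ≤ S) (hu0 : ∀ x ∈ Ω, 0 ≤ u x) (huS : ∀ x ∈ Ω, u x ≤ S)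
    (huloc : ∀ K : Set (Euc n), IsCompact K → K ⊆ Ω →
      IntegrableOn u K volume ∧ IntegrableOn (fun x => ‖du x‖ ^ p) K volume)
    (hweak : ∀ ψ : Euc n → ℝ, ContDiff ℝ (⊤ : ℕ∞) ψ → HasCompactSupport ψ → tsupport ψ ⊆ Ω →
      ∀ i : Fin n, ∫ x in Ω, u x * fderiv ℝ ψ x (EuclideanSpace.single i 1)
        = - ∫ x in Ω, du x i * ψ x)
    (hsol : ∀ ψ : Euc n → ℝ, ContDiff ℝ (⊤ : ℕ∞) ψ → HasCompactSupport ψ → tsupport ψ ⊆ Ω →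
      ∫ x in Ω, ‖du x‖ ^ (p - 2) * ⟪du x, gradient ψ x⟫ = ∫ x, ψ x ∂ν)
    (hflux : ∀ ψ : Euc n → ℝ, ContDiff ℝ (⊤ : ℕ∞) ψ → HasCompactSupport ψ → tsupport ψ ⊆ Ω →
      IntegrableOn (fun x => ‖du x‖ ^ (p - 2) * ⟪du x, gradient ψ x⟫) Ω)
    {φ : Euc n → ℝ} (hφ : ContDiff ℝ (⊤ : ℕ∞) φ) (hφc : HasCompactSupport φ)
    (hφΩ : tsupport φ ⊆ Ω) (hφ0 : ∀ x, 0 ≤ φ x) {ε δ : ℝ} (hε : 0 < ε) (hδ : 0 < δ) :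
    (∫ x, ((φ x ^ 2 + δ ^ 2) ^ (p / 2) - (δ ^ 2) ^ (p / 2)) ∂ν) * (S + ε) ^ (1 - p)
      ≤ (∫ x in Ω, ‖gradient φ x‖ ^ p)
        + (p - 1) * (δ ^ 2) ^ (p / 2) * ε ^ (-p) * ∫ x in tsupport φ, ‖du x‖ ^ p := by
  set Φ : Euc n → ℝ := fun x => (φ x ^ 2 + δ ^ 2) ^ (p / 2) - (δ ^ 2) ^ (p / 2) with hΦdef
  have hpos : ∀ x, 0 < φ x ^ 2 + δ ^ 2 := fun x => by positivity
  have hΦ : ContDiff ℝ (⊤ : ℕ∞) Φ :=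
    (((hφ.pow 2).add contDiff_const).rpow_const_of_ne fun x => (hpos x).ne').sub contDiff_const
  have hΦz : ∀ x, φ x = 0 → Φ x = 0 := fun x hx => by simp [hΦdef, hx]
  have hΦt : tsupport Φ ⊆ tsupport φ := closure_mono fun x hx h => hx (hΦz x h)
  have hΦc : HasCompactSupport Φ := hφc.of_isClosed_subset (isClosed_tsupport _) hΦt
  have hΦ0 : ∀ x, 0 ≤ Φ x := fun x => sub_nonneg.2
    (Real.rpow_le_rpow (by positivity) (by linarith [sq_nonneg (φ x)]) (by linarith))
  obtain ⟨hi, hle⟩ := integral_mul_le_integral_flux hp hΩ hS hu0 huS huloc hweak hsol hflux hΦ hΦc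
    (hΦt.trans hφΩ) hΦ0 hε
  have hgrad : ∀ (F : Euc n) x, ⟪F, gradient Φ x⟫
      = p * φ x * (φ x ^ 2 + δ ^ 2) ^ (p / 2 - 1) * ⟪F, gradient φ x⟫ := by
    intro F x
    have h := (hφ.differentiable (by simp) x).hasFDerivAt
    have h2 := (((h.pow 2).add_const (δ ^ 2)).rpow_const (p := p / 2)
      (Or.inl (hpos x).ne')).sub_const ((δ ^ 2) ^ (p / 2))
    rw [inner_gradient_right, inner_gradient_right]
    have h3 : fderiv ℝ Φ x = _ := h2.fderiv
    rw [h3]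
    simp
    ring
  have hφi : Integrable fun x => ‖gradient φ x‖ ^ p := by
    have hc : Continuous (gradient φ) :=
      (InnerProductSpace.toDual ℝ (Euc n)).symm.continuous.comp (hφ.continuous_fderiv (by simp))
    refine (hc.norm.rpow_const fun x => Or.inr (by linarith)).integrable_of_hasCompactSupport ?_
    refine (hφc.fderiv ℝ).mono fun x hx h => hx ?_
    simp only [gradient, h, map_zero, norm_zero]
    exact Real.zero_rpow (by linarith)
  have hTm : MeasurableSet (tsupport φ) := (isClosed_tsupport φ).measurableSet
  set c := (p - 1) * (δ ^ 2) ^ (p / 2) * ε ^ (-p) with hc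
  have hdui : Integrable ((tsupport φ).indicator fun x => ‖du x‖ ^ p) :=
    (integrable_indicator_iff hTm).2 (huloc _ hφc hφΩ).2
  refine hle.trans ?_
  calc _ ≤ ∫ x in Ω, (‖gradient φ x‖ ^ p + c * (tsupport φ).indicator (fun x => ‖du x‖ ^ p) x) := by
        refine setIntegral_mono_on hi (hφi.add (hdui.const_mul c)).integrableOn hΩ.measurableSet
          fun x hx => ?_
        by_cases hxT : x ∈ tsupport φ
        · rw [hgrad, indicator_of_mem hxT]
          exact picone_regularized hp _ _ (hφ0 x) hδ hε (by linarith [hu0 x hx])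
        · rw [hgrad, hΦz x (image_eq_zero_of_notMem_tsupport hxT),
            image_eq_zero_of_notMem_tsupport hxT, indicator_of_notMem hxT]
          simp only [mul_zero, zero_mul, add_zero]
          positivity
    _ = _ := by
        rw [integral_add hφi.integrableOn (hdui.const_mul c).integrableOn, integral_const_mul,
          setIntegral_indicator hTm, inter_eq_self_of_subset_right hφΩ]

/-- **Picone embedding**: a measure with a bounded nonnegative potential embeds `W₀^{1,p}`. -/
theorem integral_rpow_le_of_bounded_solution {n : ℕ} {p : ℝ} (hp : 1 < p) {Ω : Set (Euc n)}
    (hΩ : IsOpen Ω) {ν : Measure (Euc n)} [IsFiniteMeasureOnCompacts ν] {u : Euc n → ℝ}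
    {du : Euc n → Euc n} {S : ℝ} (hS : 0 ≤ S) (hu0 : ∀ x ∈ Ω, 0 ≤ u x) (huS : ∀ x ∈ Ω, u x ≤ S)
    (huloc : ∀ K : Set (Euc n), IsCompact K → K ⊆ Ω →
      IntegrableOn u K volume ∧ IntegrableOn (fun x => ‖du x‖ ^ p) K volume)
    (hweak : ∀ ψ : Euc n → ℝ, ContDiff ℝ (⊤ : ℕ∞) ψ → HasCompactSupport ψ → tsupport ψ ⊆ Ω →
      ∀ i : Fin n, ∫ x in Ω, u x * fderiv ℝ ψ x (EuclideanSpace.single i 1)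
        = - ∫ x in Ω, du x i * ψ x)
    (hsol : ∀ ψ : Euc n → ℝ, ContDiff ℝ (⊤ : ℕ∞) ψ → HasCompactSupport ψ → tsupport ψ ⊆ Ω →
      ∫ x in Ω, ‖du x‖ ^ (p - 2) * ⟪du x, gradient ψ x⟫ = ∫ x, ψ x ∂ν)
    {φ : Euc n → ℝ} (hφ : ContDiff ℝ (⊤ : ℕ∞) φ) (hφc : HasCompactSupport φ)
    (hφΩ : tsupport φ ⊆ Ω) (hφ0 : ∀ x, 0 ≤ φ x) :
    ∫ x, φ x ^ p ∂ν ≤ S ^ (p - 1) * ∫ x in Ω, ‖gradient φ x‖ ^ p := by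
  have hJ0 : 0 ≤ ∫ x in Ω, ‖gradient φ x‖ ^ p := integral_nonneg fun x => by positivity
  by_cases hflux : ∀ ψ : Euc n → ℝ, ContDiff ℝ (⊤ : ℕ∞) ψ → HasCompactSupport ψ →
      tsupport ψ ⊆ Ω → IntegrableOn (fun x => ‖du x‖ ^ (p - 2) * ⟪du x, gradient ψ x⟫) Ω
  swap
  · -- If some flux is not integrable, linearity in the test function forces `ν = 0` on `Ω`.
    push Not at hflux
    obtain ⟨ψ, hψ, hψc, hψΩ, hψi⟩ := hflux
    have hundef : ∀ θ : Euc n → ℝ, ContDiff ℝ (⊤ : ℕ∞) θ → HasCompactSupport θ →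
        tsupport θ ⊆ Ω → ¬ IntegrableOn (fun x => ‖du x‖ ^ (p - 2) * ⟪du x, gradient θ x⟫) Ω →
        ∫ x, θ x ∂ν = 0 := fun θ h1 h2 h3 h4 => by
      rw [← hsol θ h1 h2 h3]; exact integral_undef h4
    have hφν : Integrable φ ν := hφ.continuous.integrable_of_hasCompactSupport hφc
    have hψν : Integrable ψ ν := hψ.continuous.integrable_of_hasCompactSupport hψc
    have hzero : ∫ x, φ x ∂ν = 0 := by
      by_cases hφi : IntegrableOn (fun x => ‖du x‖ ^ (p - 2) * ⟪du x, gradient φ x⟫) Ω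
      swap
      · exact hundef φ hφ hφc hφΩ hφi
      have hsum := hundef (φ + ψ) (hφ.add hψ) (hφc.add hψc)
        ((tsupport_add φ ψ).trans (union_subset hφΩ hψΩ)) fun h => hψi <| by
          refine (h.sub hφi).congr (.of_forall fun x => ?_)
          have : gradient (φ + ψ) x = gradient φ x + gradient ψ x := by
            rw [gradient, fderiv_add (hφ.differentiable (by simp) x)
              (hψ.differentiable (by simp) x), map_add]
            rfl
          simp only [Pi.sub_apply, this, inner_add_right]
          ring
      have hψ0 := hundef ψ hψ hψc hψΩ hψi
      simp only [Pi.add_apply] at hsum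
      rw [integral_add hφν hψν, hψ0, add_zero] at hsum
      exact hsum
    have hae := (integral_eq_zero_iff_of_nonneg hφ0 hφν).1 hzero
    have : ∫ x, φ x ^ p ∂ν = 0 := integral_eq_zero_of_ae <| by
      filter_upwards [hae] with x hx
      simp [hx, Real.zero_rpow (by linarith : p ≠ 0)]
    rw [this]
    positivity
  have hε : ∀ ε : ℝ, 0 < ε →
      ∫ x, φ x ^ p ∂ν ≤ (S + ε) ^ (p - 1) * ∫ x in Ω, ‖gradient φ x‖ ^ p := by
    intro ε hε
    set δ : ℕ → ℝ := fun j => 1 / ((j : ℝ) + 1) with hδ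
    have hδ0 : ∀ j, 0 < δ j := fun j => by positivity
    have hδ1 : ∀ j, δ j ≤ 1 := fun j => by
      rw [hδ]; simp only
      rw [div_le_one (by positivity)]
      linarith [(Nat.cast_nonneg j : (0 : ℝ) ≤ j)]
    have hδlim : Tendsto δ atTop (𝓝 0) := tendsto_one_div_add_atTop_nhds_zero_nat
    have hδp : Tendsto (fun j => (δ j ^ 2) ^ (p / 2)) atTop (𝓝 0) := by
      have := (hδlim.pow 2).rpow_const (p := p / 2) (Or.inr (by linarith))
      simpa [Real.zero_rpow (by linarith : p / 2 ≠ 0)] using this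
    have hleft : Tendsto
        (fun j => ∫ x, ((φ x ^ 2 + δ j ^ 2) ^ (p / 2) - (δ j ^ 2) ^ (p / 2)) ∂ν) atTop
        (𝓝 (∫ x, φ x ^ p ∂ν)) := by
      have hcont : ∀ t : ℝ, Continuous fun x => (φ x ^ 2 + t) ^ (p / 2) := fun t =>
        ((hφ.continuous.pow 2).add continuous_const).rpow_const fun x => Or.inr (by linarith)
      refine tendsto_integral_of_dominated_convergence
        ((tsupport φ).indicator fun x => (φ x ^ 2 + 1) ^ (p / 2))
        (fun j => ((hcont _).sub continuous_const).aestronglyMeasurable)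
        ((integrable_indicator_iff (isClosed_tsupport φ).measurableSet).2
          ((hcont 1).continuousOn.integrableOn_compact hφc))
        (fun j => .of_forall fun x => ?_) (.of_forall fun x => ?_)
      · by_cases hx : x ∈ tsupport φ
        · have h1 : (δ j ^ 2) ^ (p / 2) ≤ (φ x ^ 2 + δ j ^ 2) ^ (p / 2) :=
            Real.rpow_le_rpow (by positivity) (by linarith [sq_nonneg (φ x)]) (by linarith)
          have h2 : (φ x ^ 2 + δ j ^ 2) ^ (p / 2) ≤ (φ x ^ 2 + 1) ^ (p / 2) :=
            Real.rpow_le_rpow (by positivity)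
              (by linarith [pow_le_one₀ (n := 2) (hδ0 j).le (hδ1 j)]) (by linarith)
          have h3 : 0 ≤ (δ j ^ 2) ^ (p / 2) := by positivity
          rw [indicator_of_mem hx, Real.norm_eq_abs, abs_of_nonneg (by linarith)]
          linarith
        · simp [indicator_of_notMem hx, image_eq_zero_of_notMem_tsupport hx]
      · have h1 : Tendsto (fun j => (φ x ^ 2 + δ j ^ 2) ^ (p / 2)) atTop
            (𝓝 ((φ x ^ 2 + 0 ^ 2) ^ (p / 2))) :=
          ((hδlim.pow 2).const_add _).rpow_const (Or.inr (by linarith))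
        have h2 : (φ x ^ 2 + 0 ^ 2) ^ (p / 2) - 0 = φ x ^ p := by
          rw [zero_pow two_ne_zero, add_zero, sub_zero, ← Real.rpow_two, ← Real.rpow_mul (hφ0 x)]
          ring_nf
        rw [← h2]
        exact h1.sub hδp
    have hright : Tendsto (fun j => (∫ x in Ω, ‖gradient φ x‖ ^ p)
        + (p - 1) * (δ j ^ 2) ^ (p / 2) * ε ^ (-p) * ∫ x in tsupport φ, ‖du x‖ ^ p) atTop
        (𝓝 (∫ x in Ω, ‖gradient φ x‖ ^ p)) := by
      have := ((((hδp.const_mul (p - 1)).mul_const (ε ^ (-p))).mul_const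
        (∫ x in tsupport φ, ‖du x‖ ^ p)).const_add (∫ x in Ω, ‖gradient φ x‖ ^ p))
      simpa using this
    have hle := le_of_tendsto_of_tendsto' (hleft.mul_const ((S + ε) ^ (1 - p))) hright fun j =>
      integral_regularized_mul_le hp hΩ hS hu0 huS huloc hweak hsol hflux hφ hφc hφΩ hφ0 hε (hδ0 j)
    have hSε : 0 < S + ε := by linarith
    have hinv : (S + ε) ^ (p - 1) * (S + ε) ^ (1 - p) = 1 := by
      rw [← Real.rpow_add hSε]; simp
    calc ∫ x, φ x ^ p ∂ν
        = (S + ε) ^ (p - 1) * ((∫ x, φ x ^ p ∂ν) * (S + ε) ^ (1 - p)) := by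
          rw [mul_left_comm, hinv, mul_one]
      _ ≤ _ := by gcongr
  have hlim : Tendsto (fun ε : ℝ => (S + ε) ^ (p - 1) * ∫ x in Ω, ‖gradient φ x‖ ^ p) (𝓝[>] 0)
      (𝓝 (S ^ (p - 1) * ∫ x in Ω, ‖gradient φ x‖ ^ p)) := by
    have h0 : Tendsto (fun ε : ℝ => S + ε) (𝓝[>] 0) (𝓝 S) := by
      have : Tendsto (fun ε : ℝ => S + ε) (𝓝 0) (𝓝 (S + 0)) := tendsto_id.const_add S
      rw [add_zero] at this
      exact this.mono_left nhdsWithin_le_nhds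
    exact (h0.rpow_const (Or.inr (by linarith))).mul_const _
  exact ge_of_tendsto hlim (by filter_upwards [self_mem_nhdsWithin] with ε h using hε ε h)

theorem Metric.infDist_frontier_le_diam {α : Type*} [PseudoMetricSpace α] {s : Set α}
    (hs : Bornology.IsBounded s) {x : α} (hx : x ∈ s) : infDist x (frontier s) ≤ diam s := by
  rcases (frontier s).eq_empty_or_nonempty with h | ⟨y, hy⟩
  · rw [h, infDist_empty]; exact diam_nonneg
  · rw [← diam_closure s]
    exact (infDist_le_dist_of_mem hy).trans
      (dist_le_diam_of_mem hs.closure (subset_closure hx) (frontier_subset_closure hy))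

end Embedding


/-- **Embedding via Picone's inequality.**  Let `Ω ⊂ ℝⁿ` be bounded open satisfying the
capacity density condition on all of `∂Ω`, `1 < p ≤ n`, `q ∈ (n/p, ∞]`,
`β = (p − n/q)/(p−1)`, and let `ν ≥ 0` satisfy the floated Morrey bound
`ν(Ω ∩ B(x,r)) ≤ M r^{n/q'}` for `x ∈ Ω`, `0 < r < δ(x)/2`.  If `u` (weak gradient `du`)
is a weak solution of `−Δ_p u = ν`, `u = 0` on `∂Ω`, with
`0 ≤ u(x) ≤ C diam(Ω)^{β−β₀} M^{1/(p−1)} δ(x)^{β₀}`, then for every nonnegative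
`φ ∈ C_c^∞(Ω)`:
`∫_Ω φ^p dν ≤ C^{p−1} diam(Ω)^{(p−1)(β−β₀)+β₀(p−1)} M ∫_Ω |∇φ|^p dx`. -/
theorem embedding_of_floated_morrey {n : ℕ} (p : ℝ) (hp : 1 < p) (hpn : p ≤ (n : ℝ))
    (q : ℝ≥0∞) (hq : ENNReal.ofReal ((n : ℝ) / p) < q)
    (β : ℝ) (hβ : β = (p - (n : ℝ) / q.toReal) / (p - 1))
    (Ω : Set (Euc n)) (hΩo : IsOpen Ω) (hΩb : Bornology.IsBounded Ω)
    -- capacity density condition with `Γ = ∂Ω`: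
    (hCDC : ∃ γ > (0 : ℝ), ∀ ξ ∈ frontier Ω, ∀ R : ℝ, 0 < R →
      ENNReal.ofReal γ * pCap n p (closedBall ξ R) (ball ξ (2 * R))
        ≤ pCap n p (closedBall ξ R \ Ω) (ball ξ (2 * R)))
    (ν : Measure (Euc n)) [IsFiniteMeasureOnCompacts ν] (hνΩ : ν Ωᶜ = 0)
    (M : ℝ) (hM : 0 ≤ M)
    -- floated Morrey condition on `ν` with constant `M`:
    (hMorrey : ∀ x ∈ Ω, ∀ r : ℝ, 0 < r → r < infDist x (frontier Ω) / 2 →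
      ν (Ω ∩ ball x r) ≤ ENNReal.ofReal (M * r ^ ((n : ℝ) * (1 - 1 / q.toReal))))
    (u : Euc n → ℝ) (du : Euc n → Euc n)
    (C β₀ : ℝ) (hC : 0 < C) (hβ₀ : 0 < β₀) (hβ₀β : β₀ ≤ β)
    -- the solution is nonnegative and satisfies the boundary growth bound:
    (hu0 : ∀ x ∈ Ω, 0 ≤ u x)
    (hubd : ∀ x ∈ Ω, u x ≤ C * diam Ω ^ (β - β₀) * M ^ (1 / (p - 1))
      * infDist x (frontier Ω) ^ β₀)
    -- `u ∈ W^{1,p}_loc(Ω)`: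
    (huloc : ∀ K : Set (Euc n), IsCompact K → K ⊆ Ω →
      IntegrableOn u K volume ∧ IntegrableOn (fun x => ‖du x‖ ^ p) K volume)
    -- `du` is the weak gradient of `u` in `Ω`:
    (hweak : ∀ ψ : Euc n → ℝ, ContDiff ℝ (⊤ : ℕ∞) ψ → HasCompactSupport ψ → tsupport ψ ⊆ Ω →
      ∀ i : Fin n, ∫ x in Ω, u x * fderiv ℝ ψ x (EuclideanSpace.single i 1)
        = - ∫ x in Ω, du x i * ψ x)
    -- `u` is a weak solution of `−Δ_p u = ν` in `Ω`:
    (hsol : ∀ ψ : Euc n → ℝ, ContDiff ℝ (⊤ : ℕ∞) ψ → HasCompactSupport ψ → tsupport ψ ⊆ Ω →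
      ∫ x in Ω, ‖du x‖ ^ (p - 2) * ⟪du x, gradient ψ x⟫ = ∫ x, ψ x ∂ν) :
    ∀ φ : Euc n → ℝ, ContDiff ℝ (⊤ : ℕ∞) φ → HasCompactSupport φ → tsupport φ ⊆ Ω →
      (∀ x, 0 ≤ φ x) →
      ∫ x, φ x ^ p ∂ν
        ≤ C ^ (p - 1) * diam Ω ^ ((p - 1) * (β - β₀) + β₀ * (p - 1)) * M
          * ∫ x in Ω, ‖gradient φ x‖ ^ p := by
  intro φ hφ hφc hφΩ hφ0
  have hd : 0 ≤ diam Ω := diam_nonneg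
  have hp1 : 0 < p - 1 := by linarith
  have hS : 0 ≤ C * diam Ω ^ (β - β₀) * M ^ (1 / (p - 1)) * diam Ω ^ β₀ := by positivity
  have huS : ∀ x ∈ Ω, u x ≤ C * diam Ω ^ (β - β₀) * M ^ (1 / (p - 1)) * diam Ω ^ β₀ := by
    intro x hx
    refine (hubd x hx).trans (mul_le_mul_of_nonneg_left ?_ (by positivity))
    exact Real.rpow_le_rpow infDist_nonneg (infDist_frontier_le_diam hΩb hx) hβ₀.le
  have hmain := integral_rpow_le_of_bounded_solution hp hΩo hS hu0 huS huloc hweak hsol hφ hφc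
    hφΩ hφ0
  have hconst : (C * diam Ω ^ (β - β₀) * M ^ (1 / (p - 1)) * diam Ω ^ β₀) ^ (p - 1)
      = C ^ (p - 1) * diam Ω ^ ((p - 1) * (β - β₀) + β₀ * (p - 1)) * M := by
    rw [Real.mul_rpow (by positivity) (by positivity), Real.mul_rpow (by positivity) (by positivity),
      Real.mul_rpow hC.le (by positivity), ← Real.rpow_mul hd, ← Real.rpow_mul hM,
      ← Real.rpow_mul hd, one_div_mul_cancel hp1.ne', Real.rpow_one,
      Real.rpow_add_of_nonneg hd (mul_nonneg hp1.le (by linarith)) (by positivity),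
      mul_comm (β - β₀)]
    ring
  rwa [hconst] at hmain
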